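/- arXiv:2310.09879 — 2 statements merged into one kernel-verified Lean document; each statement's English description precedes it below -/
import Mathlib

section
/- Let Ω and Θ be finite sets with |Ω| ≥ 3 and |Θ| ≥ 2. Let f : Δ(Ω) → Δ(Ω) and g_ω : Δ(Θ) → ℝ₊^Θ (ω ∈ Ω) be positive and continuous with (f, g) Gretherian-coherent. If additionally for each ω and each Blackwell experiment σ, Σ_{θ∈Θ} g_ω(σ(·|ω))(θ) = 1, then there exists ψ : Ω → ℝ₊₊ such that f(p)(ω) = ψ(ω)·p(ω) / Σ_{ω'} ψ(ω')·p(ω') for all p ∈ Δ(Ω) and ω ∈ Ω, and each g_ω is the identity map on Δ(Θ). -/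
open Finset

/-- `p` is a probability distribution on the finite set `Ω`. -/
def IsDist {Ω : Type*} [Fintype Ω] (p : Ω → ℝ) : Prop :=
  (∀ ω, 0 ≤ p ω) ∧ ∑ ω, p ω = 1

/-- The Bayesian posterior of `p` given signal realization `θ` and Blackwell
experiment `σ : Ω → Δ(Θ)`: `B_σ(p,θ)(ω) = p(ω)σ(θ|ω)/Σ_{ω'} p(ω')σ(θ|ω')`. -/
noncomputable def bayes {Ω Θ : Type*} [Fintype Ω]
    (σ : Ω → Θ → ℝ) (p : Ω → ℝ) (θ : Θ) : Ω → ℝ :=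
  fun ω => p ω * σ ω θ / ∑ ω', p ω' * σ ω' θ

/-- The pair `(f, g)` is Gretherian-coherent: distorting the prior and the signal and
then updating coincides with Bayesian updating followed by distortion of the
posterior, whenever the relevant denominators are positive. -/
def GretherCoherent {Ω Θ : Type*} [Fintype Ω] [Fintype Θ]
    (f : (Ω → ℝ) → Ω → ℝ) (g : Ω → (Θ → ℝ) → Θ → ℝ) : Prop :=
  ∀ p : Ω → ℝ, IsDist p → ∀ σ : Ω → Θ → ℝ, (∀ ω, IsDist (σ ω)) → ∀ θ : Θ,
    0 < ∑ ω', p ω' * σ ω' θ → 0 < ∑ ω', f p ω' * g ω' (σ ω') θ →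
    ∀ ω : Ω, f (bayes σ p θ) ω =
      f p ω * g ω (σ ω) θ / ∑ ω', f p ω' * g ω' (σ ω') θ


/-- A nonnegative function on the unit interval that is additive there and maps 1 to 1
lies above the identity. -/
lemma aux_lower (h : ℝ → ℝ) (h1 : h 1 = 1) (h0 : h 0 = 0)
    (hnn : ∀ x, 0 ≤ x → x ≤ 1 → 0 ≤ h x)
    (hadd : ∀ x y, 0 ≤ x → 0 ≤ y → x + y ≤ 1 → h (x + y) = h x + h y)
    (x : ℝ) (hx0 : 0 ≤ x) (hx1 : x ≤ 1) : x ≤ h x := by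
  have hmul : ∀ (m : ℕ) (y : ℝ), 0 ≤ y → m * y ≤ 1 → h (m * y) = m * h y := by
    intro m y hy
    induction m with
    | zero => intro _; simp [h0]
    | succ k ih =>
      intro hk
      push_cast at hk ⊢
      have e : ((k : ℝ) + 1) * y = k * y + y := by ring
      have hky : (0 : ℝ) ≤ k * y := by positivity
      rw [e, hadd _ _ hky hy (by linarith), ih (by linarith)]
      ring
  refine le_of_forall_pos_le_add ?_
  intro ε hε
  obtain ⟨n, hn⟩ := exists_nat_gt (1 / ε)
  have hnpos : (0 : ℝ) < n := lt_trans (by positivity) hn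
  have hnε : 1 < n * ε := by
    rw [div_lt_iff₀ hε] at hn; exact hn
  have hn1 : h (1 / n) = 1 / n := by
    have := hmul n (1 / n) (by positivity) (by field_simp; exact le_refl _)
    rw [show (n : ℝ) * (1 / n) = 1 by field_simp, h1] at this
    field_simp
    linarith
  set m := ⌊(n : ℝ) * x⌋₊ with hm
  have hm1 : (m : ℝ) ≤ n * x := Nat.floor_le (by positivity)
  have hm2 : (n : ℝ) * x < m + 1 := Nat.lt_floor_add_one _
  have hmx : (m : ℝ) * (1 / n) ≤ x := by
    rw [mul_one_div, div_le_iff₀ hnpos]; linarith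
  have hmn : h (m * (1 / n)) = m * (1 / n) := by
    rw [hmul m (1 / n) (by positivity) (by linarith), hn1]
  have hz : (0 : ℝ) ≤ m * (1 / n) := by positivity
  have hsplit := hadd (m * (1 / n)) (x - m * (1 / n)) hz (by linarith) (by linarith)
  have hrest := hnn (x - m * (1 / n)) (by linarith) (by linarith)
  rw [show (m : ℝ) * (1 / n) + (x - m * (1 / n)) = x by ring, hmn] at hsplit
  have : x ≤ m * (1 / n) + ε := by
    rw [mul_one_div, ← sub_le_iff_le_add, le_div_iff₀ hnpos]
    nlinarith
  linarith

/-- A nonnegative multiplicative function on the unit interval with `h x + h (1 - x) = 1`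
is the identity. -/
lemma aux_id (h : ℝ → ℝ) (h1 : h 1 = 1) (h0 : h 0 = 0)
    (hnn : ∀ x, 0 ≤ x → x ≤ 1 → 0 ≤ h x)
    (hmul : ∀ x y, 0 < x → x ≤ 1 → 0 < y → y ≤ 1 → h (x * y) = h x * h y)
    (hc : ∀ x, 0 ≤ x → x ≤ 1 → h x + h (1 - x) = 1)
    (x : ℝ) (hx0 : 0 ≤ x) (hx1 : x ≤ 1) : h x = x := by
  have hadd : ∀ x y, 0 ≤ x → 0 ≤ y → x + y ≤ 1 → h (x + y) = h x + h y := by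
    intro x y hx hy hxy
    rcases hx.eq_or_lt with rfl | hx
    · simp [h0]
    rcases hy.eq_or_lt with rfl | hy
    · simp [h0]
    have hs : 0 < x + y := by linarith
    have ex := hmul (x + y) (x / (x + y)) hs hxy (by positivity)
      (by rw [div_le_one hs]; linarith)
    have ey := hmul (x + y) (y / (x + y)) hs hxy (by positivity)
      (by rw [div_le_one hs]; linarith)
    rw [mul_div_cancel₀ _ hs.ne'] at ex ey
    have hcc := hc (x / (x + y)) (by positivity) (by rw [div_le_one hs]; linarith)
    rw [show 1 - x / (x + y) = y / (x + y) by field_simp; ring] at hcc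
    rw [ex, ey, ← mul_add, hcc, mul_one]
  have l1 := aux_lower h h1 h0 hnn hadd x hx0 hx1
  have l2 := aux_lower h h1 h0 hnn hadd (1 - x) (by linarith) (by linarith)
  have := hc x hx0 hx1
  linarith

open Classical in
/-- The distribution with mass `x` on `a` and `1 - x` elsewhere (on `b`). -/
noncomputable def twoPt {Θ : Type*} (a b : Θ) (x : ℝ) : Θ → ℝ :=
  fun t => if t = a then x else if t = b then 1 - x else 0

lemma twoPt_left {Θ : Type*} (a b : Θ) (x : ℝ) : twoPt a b x a = x := by simp [twoPt]

lemma twoPt_right {Θ : Type*} {a b : Θ} (hab : a ≠ b) (x : ℝ) : twoPt a b x b = 1 - x := by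
  simp [twoPt, hab.symm]

lemma twoPt_sum {Θ : Type*} [Fintype Θ] {a b : Θ} (hab : a ≠ b) (F : Θ → ℝ)
    (hF : ∀ t, t ≠ a → t ≠ b → F t = 0) : ∑ t, F t = F a + F b := by
  classical
  rw [← Finset.sum_pair hab]
  symm
  apply Finset.sum_subset (Finset.subset_univ _)
  intro t _ ht
  simp only [Finset.mem_insert, Finset.mem_singleton, not_or] at ht
  exact hF t ht.1 ht.2

lemma twoPt_dist {Θ : Type*} [Fintype Θ] {a b : Θ} (hab : a ≠ b) {x : ℝ}
    (h0 : 0 ≤ x) (h1 : x ≤ 1) : IsDist (twoPt a b x) := by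
  constructor
  · intro t
    unfold twoPt
    split_ifs <;> linarith
  · rw [twoPt_sum hab]
    · rw [twoPt_left, twoPt_right hab]; ring
    · intro t h h'
      simp [twoPt, h, h']

lemma IsDist.le_one {Θ : Type*} [Fintype Θ] {s : Θ → ℝ} (hs : IsDist s) (t : Θ) : s t ≤ 1 := by
  rw [← hs.2]
  exact Finset.single_le_sum (fun i _ => hs.1 i) (Finset.mem_univ t)

/-- **Corollary**: if additionally distorted signal probabilities sum to one, then `f`
is weighted (`α = 1`) and each `g_ω` is the identity map on `Δ(Θ)`. -/
theorem stmt7 {Ω Θ : Type*} [Fintype Ω] [Fintype Θ]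
    (hΩ : 3 ≤ Fintype.card Ω) (hΘ : 2 ≤ Fintype.card Θ)
    (f : (Ω → ℝ) → Ω → ℝ) (hfmap : ∀ p, IsDist p → IsDist (f p))
    (g : Ω → (Θ → ℝ) → Θ → ℝ)
    (hgnn : ∀ (ω : Ω) σ, IsDist σ → ∀ θ, 0 ≤ g ω σ θ)
    (hfpos : ∀ p, IsDist p → ∀ ω, (f p ω = 0 ↔ p ω = 0))
    (hfcont : ContinuousOn f {p | IsDist p})
    (hgpos : ∀ ω : Ω, ∀ σ, IsDist σ → ∀ θ, (g ω σ θ = 0 ↔ σ θ = 0))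
    (hgcont : ∀ ω : Ω, ContinuousOn (g ω) {σ | IsDist σ})
    (hcoh : GretherCoherent f g)
    (hsum : ∀ (ω : Ω) (σ : Ω → Θ → ℝ), (∀ ω', IsDist (σ ω')) →
      ∑ θ, g ω (σ ω) θ = 1) :
    (∃ ψ : Ω → ℝ, (∀ ω, 0 < ψ ω) ∧
        ∀ p, IsDist p → ∀ ω, f p ω = ψ ω * p ω / ∑ ω', ψ ω' * p ω') ∧
      ∀ (ω : Ω) (σ : Θ → ℝ), IsDist σ → g ω σ = σ := by
  classical
  have : Nontrivial Ω := Fintype.one_lt_card_iff_nontrivial.mp (by omega)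
  have : Nontrivial Θ := Fintype.one_lt_card_iff_nontrivial.mp (by omega)
  have hcard : (0 : ℝ) < Fintype.card Ω := by
    have : 0 < Fintype.card Ω := by omega
    exact_mod_cast this
  -- uniform prior
  set n : ℝ := ((Fintype.card Ω : ℕ) : ℝ) with hn
  set u : Ω → ℝ := fun _ => 1 / n with hu
  have hud : IsDist u := by
    refine ⟨fun _ => by positivity, ?_⟩
    simp [hu, ← hn, hcard.ne']
  have hfu : ∀ ω, 0 < f u ω := fun ω =>
    lt_of_le_of_ne ((hfmap u hud).1 ω) (fun h => by
      have := (hfpos u hud ω).1 h.symm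
      simp [hu, hcard.ne'] at this)
  have hg0 : ∀ ω s, IsDist s → ∀ θ, 0 < s θ → 0 < g ω s θ := fun ω s hs θ h =>
    lt_of_le_of_ne (hgnn ω s hs θ) (fun h' => by
      have := (hgpos ω s hs θ).1 h'.symm
      linarith)
  have hgs : ∀ ω s, IsDist s → ∑ θ, g ω s θ = 1 := fun ω s hs =>
    hsum ω (fun _ => s) (fun _ => hs)
  -- key identity
  have key : ∀ a b : Ω, a ≠ b → ∀ s t s' t' : Θ → ℝ, IsDist s → IsDist t → IsDist s' →
      IsDist t' → ∀ θ θ' : Θ, ∀ c : ℝ, 0 < c → 0 < s' θ' → 0 < t' θ' →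
      s θ = c * s' θ' → t θ = c * t' θ' →
      g a s θ * g b t' θ' = g b t θ * g a s' θ' := by
    intro a b hab s t s' t' hs ht hs' ht' θ θ' c hc ps pt es et
    set σ : Ω → Θ → ℝ := fun ω => if ω = a then s else t with hσ
    set τ : Ω → Θ → ℝ := fun ω => if ω = a then s' else t' with hτ
    have dσ : ∀ ω, IsDist (σ ω) := by intro ω; simp only [hσ]; split_ifs <;> assumption
    have dτ : ∀ ω, IsDist (τ ω) := by intro ω; simp only [hτ]; split_ifs <;> assumption
    have pτ : ∀ ω, 0 < τ ω θ' := by intro ω; simp only [hτ]; split_ifs <;> assumption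
    have e : ∀ ω, σ ω θ = c * τ ω θ' := by
      intro ω; simp only [hσ, hτ]; split_ifs <;> assumption
    have pσ : ∀ ω, 0 < σ ω θ := by intro ω; rw [e]; exact mul_pos hc (pτ ω)
    have hune : (univ : Finset Ω).Nonempty := ⟨a, mem_univ a⟩
    have S1 : 0 < ∑ ω', u ω' * σ ω' θ :=
      sum_pos (fun ω _ => mul_pos (by positivity) (pσ ω)) hune
    have S2 : 0 < ∑ ω', u ω' * τ ω' θ' :=
      sum_pos (fun ω _ => mul_pos (by positivity) (pτ ω)) hune
    have S3 : 0 < ∑ ω', f u ω' * g ω' (σ ω') θ :=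
      sum_pos (fun ω _ => mul_pos (hfu ω) (hg0 ω _ (dσ ω) _ (pσ ω))) hune
    have S4 : 0 < ∑ ω', f u ω' * g ω' (τ ω') θ' :=
      sum_pos (fun ω _ => mul_pos (hfu ω) (hg0 ω _ (dτ ω) _ (pτ ω))) hune
    have hb : bayes σ u θ = bayes τ u θ' := by
      funext ω
      unfold bayes
      have : ∑ ω', u ω' * σ ω' θ = c * ∑ ω', u ω' * τ ω' θ' := by
        rw [mul_sum]
        refine sum_congr rfl (fun ω _ => ?_)
        rw [e]; ring
      rw [this, e, div_eq_div_iff (by positivity) S2.ne']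
      ring
    have C : ∀ ω, g ω (σ ω) θ * (∑ ω', f u ω' * g ω' (τ ω') θ')
        = g ω (τ ω) θ' * (∑ ω', f u ω' * g ω' (σ ω') θ) := by
      intro ω
      have c1 := hcoh u hud σ dσ θ S1 S3 ω
      have c2 := hcoh u hud τ dτ θ' S2 S4 ω
      rw [hb, c2, div_eq_div_iff S4.ne' S3.ne'] at c1
      have := hfu ω
      apply mul_left_cancel₀ this.ne'
      linarith
    have Ca := C a
    have Cb := C b
    have σa : σ a = s := by simp [hσ]
    have σb : σ b = t := by simp [hσ, hab.symm]
    have τa : τ a = s' := by simp [hτ]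
    have τb : τ b = t' := by simp [hτ, hab.symm]
    rw [σa, τa] at Ca
    rw [σb, τb] at Cb
    apply mul_right_cancel₀ (mul_pos S3 S4).ne'
    linear_combination (g b t' θ' * (∑ ω', f u ω' * g ω' (σ ω') θ)) * Ca
      - (g a s' θ' * (∑ ω', f u ω' * g ω' (σ ω') θ)) * Cb
  -- point masses
  have hdelta : ∀ θ : Θ, ∃ d : Θ → ℝ, IsDist d ∧ d θ = 1 ∧ ∀ ω, g ω d θ = 1 := by
    intro θ
    obtain ⟨θ', hne⟩ := exists_ne θ
    have hd := twoPt_dist hne.symm (x := 1) (by norm_num) le_rfl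
    refine ⟨twoPt θ θ' 1, hd, twoPt_left _ _ _, fun ω => ?_⟩
    have := hgs ω _ hd
    rw [twoPt_sum hne.symm] at this
    · rw [(hgpos ω _ hd θ').2 (by rw [twoPt_right hne.symm]; ring)] at this
      linarith
    · intro t h h'
      exact (hgpos ω _ hd t).2 (by simp [twoPt, h, h'])
  have mulid : ∀ a b : Ω, a ≠ b → ∀ s t s' : Θ → ℝ, IsDist s → IsDist t → IsDist s' →
      ∀ θ θ' : Θ, 0 < t θ → 0 < s' θ' → s θ = t θ * s' θ' →
      g a s θ = g b t θ * g a s' θ' := by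
    intro a b hab s t s' hs ht hs' θ θ' pt ps' e
    obtain ⟨d, hd, d1, hgd⟩ := hdelta θ'
    have := key a b hab s t s' d hs ht hs' hd θ θ' (t θ) pt ps' (by rw [d1]; norm_num) e
      (by rw [d1]; ring)
    rw [hgd, mul_one] at this
    exact this
  have samea : ∀ a : Ω, ∀ s s' : Θ → ℝ, IsDist s → IsDist s' → ∀ θ θ' : Θ, s θ = s' θ' →
      g a s θ = g a s' θ' := by
    intro a s s' hs hs' θ θ' e
    rcases (hs'.1 θ').eq_or_lt with h | h
    · rw [(hgpos a s hs θ).2 (by rw [e, h]), (hgpos a s' hs' θ').2 h.symm]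
    obtain ⟨b, hb⟩ := exists_ne a
    obtain ⟨d, hd, d1, hgd⟩ := hdelta θ
    have := mulid a b hb.symm s d s' hs hd hs' θ θ' (by rw [d1]; norm_num) h
      (by rw [d1, e, one_mul])
    rw [this, hgd, one_mul]
  have sameb : ∀ a b : Ω, a ≠ b → ∀ s : Θ → ℝ, IsDist s → ∀ θ : Θ,
      g a s θ = g b s θ := by
    intro a b hab s hs θ
    rcases (hs.1 θ).eq_or_lt with h | h
    · rw [(hgpos a s hs θ).2 h.symm, (hgpos b s hs θ).2 h.symm]
    obtain ⟨d, hd, d1, hgd⟩ := hdelta θ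
    have := mulid a b hab s s d hs hs hd θ θ h (by rw [d1]; norm_num) (by rw [d1, mul_one])
    rw [this, hgd, mul_one]
  have hgid : ∀ (ω : Ω) (s : Θ → ℝ), IsDist s → ∀ θ, g ω s θ = s θ := by
    intro a s hs θ
    obtain ⟨b, hb⟩ := exists_ne a
    obtain ⟨θ', hne⟩ := exists_ne θ
    have D : ∀ x : ℝ, 0 ≤ x → x ≤ 1 → IsDist (twoPt θ θ' x) := fun x h h' =>
      twoPt_dist hne.symm h h'
    have res := aux_id (fun x => g a (twoPt θ θ' x) θ) ?_ ?_ ?_ ?_ ?_ (s θ) (hs.1 θ)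
      (hs.le_one θ)
    · rw [← samea a s _ hs (D _ (hs.1 θ) (hs.le_one θ)) θ θ (twoPt_left _ _ _).symm] at res
      exact res
    · obtain ⟨d, hd, d1, hgd⟩ := hdelta θ
      show g a (twoPt θ θ' 1) θ = 1
      rw [samea a _ d (D 1 (by norm_num) le_rfl) hd θ θ (by rw [twoPt_left, d1]), hgd]
    · exact (hgpos a _ (D 0 le_rfl (by norm_num)) θ).2 (twoPt_left _ _ _)
    · intro x h h'
      exact hgnn a _ (D x h h') θ
    · intro x y hx hx1 hy hy1
      show g a (twoPt θ θ' (x * y)) θ = g a (twoPt θ θ' x) θ * g a (twoPt θ θ' y) θ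
      rw [sameb a b hb.symm (twoPt θ θ' x) (D x hx.le hx1)]
      exact mulid a b hb.symm _ _ _ (D _ (by positivity) (by nlinarith)) (D x hx.le hx1)
        (D y hy.le hy1) θ θ (by rwa [twoPt_left]) (by rwa [twoPt_left])
        (by simp only [twoPt_left])
    · intro x hx hx1
      show g a (twoPt θ θ' x) θ + g a (twoPt θ θ' (1 - x)) θ = 1
      have hd := D x hx hx1
      have := hgs a _ hd
      rw [twoPt_sum hne.symm] at this
      · rw [samea a (twoPt θ θ' (1 - x)) (twoPt θ θ' x)
          (D (1 - x) (by linarith) (by linarith)) hd θ θ'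
          (by rw [twoPt_left, twoPt_right hne.symm])]
        exact this
      · intro t h h'
        exact (hgpos a _ hd t).2 (by simp [twoPt, h, h'])
  refine ⟨⟨f u, hfu, ?_⟩, fun ω s hs => funext (hgid ω s hs)⟩
  intro q hq ω
  obtain ⟨θ, θ', hne⟩ := exists_pair_ne Θ
  set σ : Ω → Θ → ℝ := fun ω => twoPt θ θ' (q ω) with hσ
  have dσ : ∀ ω, IsDist (σ ω) := fun ω => twoPt_dist hne (hq.1 ω) (hq.le_one ω)
  have e : ∀ ω, σ ω θ = q ω := fun ω => twoPt_left _ _ _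
  have eg : ∀ ω, g ω (σ ω) θ = q ω := fun ω => by rw [hgid ω _ (dσ ω), e]
  have hs1 : ∑ ω', u ω' * σ ω' θ = 1 / n := by
    simp only [e, hu]
    rw [← mul_sum, hq.2, mul_one]
  have hs2 : 0 < ∑ ω', f u ω' * g ω' (σ ω') θ := by
    simp only [eg]
    obtain ⟨w, hw⟩ : ∃ w, 0 < q w := by
      by_contra hcon
      push Not at hcon
      have := sum_nonpos (s := univ) (fun i _ => hcon i)
      rw [hq.2] at this
      linarith
    exact sum_pos' (fun i _ => mul_nonneg (hfu i).le (hq.1 i)) ⟨w, mem_univ w, mul_pos (hfu w) hw⟩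
  have hb : bayes σ u θ = q := by
    funext w
    unfold bayes
    rw [hs1, e]
    simp only [hu]
    field_simp
  have := hcoh u hud σ dσ θ (by rw [hs1]; positivity) hs2 ω
  rw [hb] at this
  simpa only [eg] using this
end

section
/- Let X = [x̲, x̄] ⊆ ℝ with x̲ < x̄, and let Δ(X) be the set of simple lotteries on X (finitely supported probability mass functions). A distorted belief φ : Δ(X) → Δ(X) is positive, coherent, and weakly continuous if and only if there exists a continuous function ψ : X → ℝ₊₊ such that for all p ∈ Δ(X) and all x ∈ X, φ(p)(x) = ψ(x)·p(x) / Σ_{x' : p(x') > 0} ψ(x')·p(x'). -/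
open Filter Topology
open scoped Classical

/-- `p` is a simple lottery on `X = [a, b]`: a finitely supported probability mass
function whose support lies in `[a, b]`. -/
def IsLottery (a b : ℝ) (p : ℝ → ℝ) : Prop :=
  (∀ x, 0 ≤ p x) ∧ (Function.support p).Finite ∧
    (∀ x, p x ≠ 0 → x ∈ Set.Icc a b) ∧ ∑ᶠ x, p x = 1

/-- The conditional lottery `p(·|E)`. -/
noncomputable def condLot (p : ℝ → ℝ) (E : Set ℝ) : ℝ → ℝ :=
  fun x => if x ∈ E then p x / ∑ᶠ x' ∈ E, p x' else 0

/-- `φ` is positive: `φ(p)` has the same support as `p`. -/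
def PositiveLot (a b : ℝ) (φ : (ℝ → ℝ) → ℝ → ℝ) : Prop :=
  ∀ p, IsLottery a b p → ∀ x, (φ p x = 0 ↔ p x = 0)

/-- `φ` is coherent: for every `E ⊆ [a,b]` with `p(E) > 0`,
`φ(p(·|E)) = φ(p)(·|E)`. -/
def CoherentLot (a b : ℝ) (φ : (ℝ → ℝ) → ℝ → ℝ) : Prop :=
  ∀ p, IsLottery a b p → ∀ E : Set ℝ, E ⊆ Set.Icc a b →
    0 < ∑ᶠ x ∈ E, p x → φ (condLot p E) = condLot (φ p) E

/-- `p_n` converges weakly to `q`: for every bounded continuous `f` on `[a,b]`,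
`Σ f(x) p_n(x) → Σ f(x) q(x)`. -/
def WeakConvTo (a b : ℝ) (pn : ℕ → ℝ → ℝ) (q : ℝ → ℝ) : Prop :=
  ∀ f : ℝ → ℝ, ContinuousOn f (Set.Icc a b) →
    (∃ M, ∀ x ∈ Set.Icc a b, |f x| ≤ M) →
    Tendsto (fun n => ∑ᶠ x, f x * pn n x) atTop (𝓝 (∑ᶠ x, f x * q x))

/-- `φ` is weakly continuous: it preserves weak convergence of lotteries. -/
def WeaklyContinuousLot (a b : ℝ) (φ : (ℝ → ℝ) → ℝ → ℝ) : Prop :=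
  ∀ (pn : ℕ → ℝ → ℝ) (q : ℝ → ℝ), (∀ n, IsLottery a b (pn n)) → IsLottery a b q →
    WeakConvTo a b pn q → WeakConvTo a b (fun n => φ (pn n)) (φ q)

noncomputable def T3 (x y z s t r : ℝ) : ℝ → ℝ := fun w =>
  ((if w = x then s else 0) + (if w = y then t else 0) + (if w = z then r else 0)) / (s + t + r)

lemma fin_ite (x s : ℝ) : (Function.support (fun w : ℝ => if w = x then s else 0)).Finite := by
  refine (Set.finite_singleton x).subset ?_
  intro w hw
  by_contra h
  simp at h
  simp [h] at hw

lemma fin_ite_mul (f : ℝ → ℝ) (x s : ℝ) :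
    (Function.support (fun w : ℝ => f w * if w = x then s else 0)).Finite := by
  refine (fin_ite x s).subset ?_
  intro w hw
  simp only [Function.mem_support] at hw ⊢
  exact right_ne_zero_of_mul hw

lemma finsum_ite_mul (f : ℝ → ℝ) (x s : ℝ) :
    ∑ᶠ w, f w * (if w = x then s else 0) = f x * s := by
  rw [finsum_eq_single _ x]
  · simp
  · intro w hw
    simp [hw]

lemma T3_exp (f : ℝ → ℝ) (x y z s t r : ℝ) :
    ∑ᶠ w, f w * T3 x y z s t r w = (f x * s + f y * t + f z * r) / (s + t + r) := by
  have h : (fun w => f w * T3 x y z s t r w) = fun w =>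
      ((f w * (if w = x then s else 0) + f w * (if w = y then t else 0)) +
        f w * (if w = z then r else 0)) * (s + t + r)⁻¹ := by
    funext w
    unfold T3
    ring
  have h12 : (Function.support (fun w : ℝ => f w * (if w = x then s else 0) +
      f w * (if w = y then t else 0))).Finite :=
    ((fin_ite_mul f x s).union (fin_ite_mul f y t)).subset (Function.support_add _ _)
  rw [h, ← finsum_mul, finsum_add_distrib h12 (fin_ite_mul f z r),
    finsum_add_distrib (fin_ite_mul f x s) (fin_ite_mul f y t), finsum_ite_mul, finsum_ite_mul,
    finsum_ite_mul]
  ring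

lemma T3_supp {x y z s t r w : ℝ} (h : T3 x y z s t r w ≠ 0) : w = x ∨ w = y ∨ w = z := by
  by_contra hc
  push Not at hc
  apply h
  simp [T3, hc.1, hc.2.1, hc.2.2]

lemma T3_lot {a b x y z s t r : ℝ} (hx : x ∈ Set.Icc a b) (hy : y ∈ Set.Icc a b)
    (hz : z ∈ Set.Icc a b) (hs : 0 ≤ s) (ht : 0 ≤ t) (hr : 0 ≤ r) (h : 0 < s + t + r) :
    IsLottery a b (T3 x y z s t r) := by
  refine ⟨?_, ?_, ?_, ?_⟩
  · intro w
    unfold T3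
    apply div_nonneg _ h.le
    split_ifs <;> positivity
  · refine (Set.toFinite ({x, y, z} : Set ℝ)).subset ?_
    intro w hw
    simpa using T3_supp hw
  · intro w hw
    rcases T3_supp hw with rfl | rfl | rfl <;> assumption
  · have := T3_exp (fun _ => 1) x y z s t r
    simp only [one_mul] at this
    rw [this, div_self h.ne']

lemma T3_conv {a b x y z s t r : ℝ} {u : ℕ → ℝ} (hu : ∀ n, u n ∈ Set.Icc a b)
    (hx : x ∈ Set.Icc a b) (hlim : Tendsto u atTop (𝓝 x)) :
    WeakConvTo a b (fun n => T3 (u n) y z s t r) (T3 x y z s t r) := by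
  intro f hf _
  simp only [T3_exp]
  have : Tendsto (fun n => f (u n)) atTop (𝓝 (f x)) :=
    (hf x hx).tendsto.comp (tendsto_nhdsWithin_iff.2 ⟨hlim, Eventually.of_forall hu⟩)
  exact (((this.mul_const s).add_const _).add_const _).div_const _

lemma lot_sum {a b : ℝ} {p : ℝ → ℝ} (_hp : IsLottery a b p) (f : ℝ → ℝ) (S : Finset ℝ)
    (hS : ∀ w, p w ≠ 0 → w ∈ S) : ∑ᶠ w, f w * p w = ∑ w ∈ S, f w * p w := by
  apply finsum_eq_sum_of_support_subset
  intro w hw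
  exact hS w (right_ne_zero_of_mul hw)

lemma lot_total {a b : ℝ} {p : ℝ → ℝ} (hp : IsLottery a b p) (S : Finset ℝ)
    (hS : ∀ w, p w ≠ 0 → w ∈ S) : ∑ w ∈ S, p w = 1 := by
  rw [← hp.2.2.2]
  symm
  apply finsum_eq_sum_of_support_subset
  intro w hw
  exact hS w hw

/-- two point lottery -/
noncomputable def L2 (x y s : ℝ) : ℝ → ℝ := T3 x x y s 0 1

noncomputable def gg (φ : (ℝ → ℝ) → ℝ → ℝ) (x y s : ℝ) : ℝ :=
  φ (L2 x y s) x / (1 - φ (L2 x y s) x)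

section fwd
variable {a b : ℝ} {φ : (ℝ → ℝ) → ℝ → ℝ}

lemma L2_lot {x y s : ℝ} (hx : x ∈ Set.Icc a b) (hy : y ∈ Set.Icc a b) (hs : 0 < s) :
    IsLottery a b (L2 x y s) :=
  T3_lot hx hx hy hs.le le_rfl zero_le_one (by linarith)

lemma phi_T3_supp (hpos : PositiveLot a b φ) {x y z s t r : ℝ}
    (hl : IsLottery a b (T3 x y z s t r)) (w : ℝ) (h : φ (T3 x y z s t r) w ≠ 0) :
    w ∈ ({x, y, z} : Finset ℝ) := by
  have := T3_supp (fun h0 => h ((hpos _ hl w).2 h0))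
  simpa using this

lemma L2_sum (hmap : ∀ p, IsLottery a b p → IsLottery a b (φ p))
    (hpos : PositiveLot a b φ) {x y s : ℝ} (hx : x ∈ Set.Icc a b) (hy : y ∈ Set.Icc a b)
    (hs : 0 < s) (hxy : x ≠ y) : φ (L2 x y s) x + φ (L2 x y s) y = 1 := by
  have hl := L2_lot hx hy hs
  have := lot_total (hmap _ hl) {x, x, y} (phi_T3_supp hpos hl)
  simpa [hxy] using this

lemma phi_pos (hmap : ∀ p, IsLottery a b p → IsLottery a b (φ p))
    (hpos : PositiveLot a b φ) {p : ℝ → ℝ} (hp : IsLottery a b p) {x : ℝ} (hx : 0 < p x) :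
    0 < φ p x :=
  lt_of_le_of_ne ((hmap p hp).1 x) (fun h => hx.ne' ((hpos p hp x).1 h.symm))

lemma L2_x {x y s : ℝ} (hs : 0 < s) (hxy : x ≠ y) : L2 x y s x = s / (s + 1) := by
  simp [L2, T3, hxy]

lemma L2_y {x y s : ℝ} (hxy : x ≠ y) : L2 x y s y = 1 / (s + 1) := by
  simp [L2, T3, hxy.symm]

lemma gg_eq (hmap : ∀ p, IsLottery a b p → IsLottery a b (φ p))
    (hpos : PositiveLot a b φ) {x y s : ℝ} (hx : x ∈ Set.Icc a b) (hy : y ∈ Set.Icc a b)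
    (hs : 0 < s) (hxy : x ≠ y) :
    gg φ x y s = φ (L2 x y s) x / φ (L2 x y s) y ∧ 0 < φ (L2 x y s) x ∧ 0 < φ (L2 x y s) y := by
  have hl := L2_lot hx hy hs
  have h := L2_sum hmap hpos hx hy hs hxy
  refine ⟨?_, ?_, ?_⟩
  · rw [gg, ← h]
    congr 1
    ring
  · apply phi_pos hmap hpos hl
    rw [L2_x hs hxy]
    positivity
  · apply phi_pos hmap hpos hl
    rw [L2_y hxy]
    positivity

lemma gg_pos (hmap : ∀ p, IsLottery a b p → IsLottery a b (φ p))
    (hpos : PositiveLot a b φ) {x y s : ℝ} (hx : x ∈ Set.Icc a b) (hy : y ∈ Set.Icc a b)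
    (hs : 0 < s) (hxy : x ≠ y) : 0 < gg φ x y s := by
  obtain ⟨h1, h2, h3⟩ := gg_eq hmap hpos hx hy hs hxy
  rw [h1]
  positivity

lemma finsum_pair (f : ℝ → ℝ) {x y : ℝ} (hxy : x ≠ y) :
    ∑ᶠ w ∈ ({x, y} : Set ℝ), f w = f x + f y := finsum_mem_pair hxy

lemma ratio (hmap : ∀ p, IsLottery a b p → IsLottery a b (φ p))
    (hpos : PositiveLot a b φ) (hcoh : CoherentLot a b φ) {p : ℝ → ℝ} (hp : IsLottery a b p)
    {x y : ℝ} (hxy : x ≠ y) (hx : 0 < p x) (hy : 0 < p y) :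
    φ p x = gg φ x y (p x / p y) * φ p y := by
  have hxI := hp.2.2.1 x hx.ne'
  have hyI := hp.2.2.1 y hy.ne'
  have hc := hcoh p hp {x, y} (by
    intro w hw
    rcases hw with rfl | rfl <;> assumption) (by
    rw [finsum_pair _ hxy]
    positivity)
  have hL : condLot p {x, y} = L2 x y (p x / p y) := by
    funext w
    unfold condLot L2 T3
    rw [finsum_pair _ hxy]
    by_cases h1 : w = x
    · subst h1
      simp [hxy]
      field_simp
    · by_cases h2 : w = y
      · subst h2
        simp [h1]
        field_simp
      · simp [h1, h2]
  rw [hL] at hc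
  have hs : 0 < p x / p y := by positivity
  obtain ⟨h1, -, -⟩ := gg_eq hmap hpos hxI hyI hs hxy
  have e1 := phi_pos hmap hpos hp hx
  have e2 := phi_pos hmap hpos hp hy
  rw [h1, hc]
  simp only [condLot, finsum_pair _ hxy]
  simp
  field_simp

lemma gg_tendsto (hmap : ∀ p, IsLottery a b p → IsLottery a b (φ p))
    (hpos : PositiveLot a b φ) (hw : WeaklyContinuousLot a b φ) {x y s : ℝ}
    (hx : x ∈ Set.Icc a b) (hy : y ∈ Set.Icc a b)
    (hs : 0 < s) (hxy : x ≠ y) {u : ℕ → ℝ} (hu : ∀ n, u n ∈ Set.Icc a b)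
    (hlim : Tendsto u atTop (𝓝 x)) :
    Tendsto (fun n => gg φ (u n) y s) atTop (𝓝 (gg φ x y s)) := by
  have hconv : WeakConvTo a b (fun n => L2 (u n) y s) (L2 x y s) := by
    intro f hf hb
    have := T3_conv (y := y) (z := y) (s := s) (t := 0) (r := 1) hu hx hlim f hf hb
    simp only [T3_exp, L2] at this ⊢
    simpa using this
  have h1 := hw _ _ (fun n => L2_lot (hu n) hy hs) (L2_lot hx hy hs) hconv (fun w => |w - y|)
    (by fun_prop) (by
      refine ⟨b - a, fun w hw => ?_⟩
      rw [abs_abs, abs_le]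
      constructor <;> linarith [hw.1, hw.2, hy.1, hy.2])
  have key : ∀ v ∈ Set.Icc a b, ∑ᶠ w, |w - y| * φ (L2 v y s) w = |v - y| * φ (L2 v y s) v := by
    intro v hv
    have hl := L2_lot hv hy hs
    rw [finsum_eq_single _ v]
    intro w hwv
    by_cases hwy : w = y
    · simp [hwy]
    · have : φ (L2 v y s) w = 0 := by
        rw [hpos _ hl w]
        simp [L2, T3, hwv, hwy]
      simp [this]
  rw [key x hx] at h1
  have h2 := h1.congr (fun n => key (u n) (hu n))
  have h3 : Tendsto (fun n => |u n - y|) atTop (𝓝 |x - y|) := (hlim.sub_const y).abs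
  have hne : |x - y| ≠ 0 := by simpa [sub_eq_zero] using hxy
  have h4 := h2.div h3 hne
  have h5 : Tendsto (fun n => φ (L2 (u n) y s) (u n)) atTop (𝓝 (φ (L2 x y s) x)) := by
    rw [mul_div_cancel_left₀ _ hne] at h4
    refine h4.congr' ?_
    filter_upwards [h3.eventually_ne hne] with n hn
    simp only [Pi.div_apply]
    rw [mul_div_cancel_left₀ _ hn]
  refine h5.div (h5.const_sub 1) ?_
  have := L2_sum hmap hpos hx hy hs hxy
  have := (gg_eq hmap hpos hx hy hs hxy).2.2
  linarith

lemma gg_add (hab : a < b) (hmap : ∀ p, IsLottery a b p → IsLottery a b (φ p))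
    (hpos : PositiveLot a b φ) (hcoh : CoherentLot a b φ) (hw : WeaklyContinuousLot a b φ)
    {x y s t : ℝ} (hx : x ∈ Set.Icc a b) (hy : y ∈ Set.Icc a b)
    (hs : 0 < s) (ht : 0 < t) (hxy : x ≠ y) :
    gg φ x y (s + t) = gg φ x y s + gg φ x y t := by
  obtain ⟨u, hu, hux, huy, hlim⟩ : ∃ u : ℕ → ℝ, (∀ n, u n ∈ Set.Icc a b) ∧ (∀ n, u n ≠ x) ∧
      (∀ n, u n ≠ y) ∧ Tendsto u atTop (𝓝 x) := by
    have hcl : x ∈ closure (Set.Ioo a b \ {x, y}) := by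
      have hd : Dense (({x, y} : Set ℝ)ᶜ) := Set.Countable.dense_compl ℝ (Set.toFinite ({x, y} : Set ℝ)).countable
      have := hd.open_subset_closure_inter (isOpen_Ioo (a := a) (b := b))
      have h2 := closure_minimal this isClosed_closure
      rw [closure_Ioo hab.ne] at h2
      exact h2 hx
    obtain ⟨u, hu, hl⟩ := mem_closure_iff_seq_limit.1 hcl
    refine ⟨u, fun n => Set.Ioo_subset_Icc_self (hu n).1, ?_, ?_, hl⟩
    · intro n h
      exact (hu n).2 (by simp [h])
    · intro n h
      exact (hu n).2 (by simp [h])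
  have hst : 0 < s + t := by positivity
  have hlot : ∀ v ∈ Set.Icc a b, IsLottery a b (T3 v x y s t 1) := fun v hv =>
    T3_lot hv hx hy hs.le ht.le zero_le_one (by positivity)
  have hTL : T3 x x y s t 1 = L2 x y (s + t) := by
    funext w
    unfold L2 T3
    by_cases h : w = x <;> simp [h]
  have h1 := hw _ _ (fun n => hlot (u n) (hu n)) (hlot x hx)
    (T3_conv hu hx hlim) (fun w => |w - y|)
    (by fun_prop) (by
      refine ⟨b - a, fun w hw => ?_⟩
      rw [abs_abs, abs_le]
      constructor <;> linarith [hw.1, hw.2, hy.1, hy.2])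
  have hlimit : ∑ᶠ w, |w - y| * φ (T3 x x y s t 1) w =
      |x - y| * (gg φ x y (s + t) / (1 + gg φ x y (s + t))) := by
    rw [lot_sum (hmap _ (hlot x hx)) _ {x, x, y} (phi_T3_supp hpos (hlot x hx))]
    obtain ⟨e1, e2, e3⟩ := gg_eq hmap hpos hx hy hst hxy
    have e4 := L2_sum hmap hpos hx hy hst hxy
    rw [hTL, e1]
    simp [hxy]
    left
    field_simp
    linear_combination e4
  have hterm : ∀ n, ∑ᶠ w, |w - y| * φ (T3 (u n) x y s t 1) w =
      (|u n - y| * gg φ (u n) y s + |x - y| * gg φ x y t) /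
        (1 + (gg φ (u n) y s + gg φ x y t)) := by
    intro n
    have hl := hlot (u n) (hu n)
    have hD : 0 < s + t + 1 := by positivity
    have p1 : T3 (u n) x y s t 1 (u n) = s / (s + t + 1) := by simp [T3, hux n, huy n]
    have p2 : T3 (u n) x y s t 1 x = t / (s + t + 1) := by simp [T3, (hux n).symm, hxy]
    have p3 : T3 (u n) x y s t 1 y = 1 / (s + t + 1) := by simp [T3, (huy n).symm, hxy.symm]
    have r1 := ratio hmap hpos hcoh hl (huy n) (by rw [p1]; positivity) (by rw [p3]; positivity)
    have r2 := ratio hmap hpos hcoh hl hxy (by rw [p2]; positivity) (by rw [p3]; positivity)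
    have q1 : s / (s + t + 1) / (1 / (s + t + 1)) = s := by field_simp
    have q2 : t / (s + t + 1) / (1 / (s + t + 1)) = t := by field_simp
    rw [p1, p3, q1] at r1
    rw [p2, p3, q2] at r2
    have tot := lot_total (hmap _ hl) _ (phi_T3_supp hpos hl)
    rw [lot_sum (hmap _ hl) _ _ (phi_T3_supp hpos hl)]
    have g1 := gg_pos hmap hpos (hu n) hy hs (huy n)
    have g2 := gg_pos hmap hpos hx hy ht hxy
    rw [Finset.sum_insert (by simp [hux n, huy n]), Finset.sum_pair hxy] at tot ⊢
    rw [eq_div_iff (by positivity)]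
    rw [r1, r2] at tot ⊢
    simp only [sub_self, abs_zero, zero_mul]
    linear_combination (|u n - y| * gg φ (u n) y s + |x - y| * gg φ x y t) * tot
  have g1 := gg_pos hmap hpos hx hy hs hxy
  have g2 := gg_pos hmap hpos hx hy ht hxy
  have g3 := gg_pos hmap hpos hx hy hst hxy
  have hg := gg_tendsto hmap hpos hw hx hy hs hxy hu hlim
  have h3 : Tendsto (fun n => |u n - y|) atTop (𝓝 |x - y|) := (hlim.sub_const y).abs
  have h4 := ((h3.mul hg).add_const (|x - y| * gg φ x y t)).div
    ((hg.add_const (gg φ x y t)).const_add 1) (by positivity)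
  have h5 := tendsto_nhds_unique (h1.congr hterm) h4
  rw [hlimit] at h5
  have hne : |x - y| ≠ 0 := by simpa [sub_eq_zero] using hxy
  rw [← mul_add, mul_div_assoc] at h5
  have h6 := mul_left_cancel₀ hne h5
  rw [div_eq_div_iff (by positivity) (by positivity)] at h6
  linarith

lemma add_lin {g : ℝ → ℝ} (hp : ∀ s, 0 < s → 0 < g s)
    (ha : ∀ s t, 0 < s → 0 < t → g (s + t) = g s + g t) {s : ℝ} (hs : 0 < s) :
    g s = s * g 1 := by
  have hn : ∀ (s : ℝ), 0 < s → ∀ n : ℕ, g ((n + 1 : ℕ) * s) = (n + 1 : ℕ) * g s := by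
    intro s hs n
    induction n with
    | zero => simp
    | succ k ih =>
      have : ((k + 1 + 1 : ℕ) : ℝ) * s = ((k + 1 : ℕ) : ℝ) * s + s := by push_cast; ring
      rw [this, ha _ _ (by positivity) hs, ih]
      push_cast
      ring
  have hm : ∀ s t, 0 < s → s ≤ t → g s ≤ g t := by
    intro s t hs hst
    rcases hst.eq_or_lt with rfl | h
    · exact le_rfl
    · have h1 := ha s (t - s) hs (by linarith)
      have h2 := hp (t - s) (by linarith)
      rw [add_sub_cancel] at h1
      linarith
  have h1 := hp 1 one_pos
  have hgs := hp s hs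
  have bound : ∀ n : ℕ, ((n + 1 : ℕ) : ℝ) * |g s - s * g 1| ≤ g 1 := by
    intro n
    have hns : 0 < ((n + 1 : ℕ) : ℝ) * s := by positivity
    set k := ⌊((n + 1 : ℕ) : ℝ) * s⌋₊ with hk
    have k1 : (k : ℝ) ≤ ((n + 1 : ℕ) : ℝ) * s := Nat.floor_le hns.le
    have k2 : ((n + 1 : ℕ) : ℝ) * s < k + 1 := Nat.lt_floor_add_one _
    have up : ((n + 1 : ℕ) : ℝ) * g s ≤ (k + 1) * g 1 := by
      rw [← hn s hs n]
      have := hm _ (((k + 1 : ℕ) : ℝ) * 1) hns (by rw [mul_one, Nat.cast_add_one k]; exact k2.le)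
      rw [hn 1 one_pos k] at this
      push_cast at this ⊢
      exact this
    have lo : (k : ℝ) * g 1 ≤ ((n + 1 : ℕ) : ℝ) * g s := by
      rcases k with _ | j
      · simp only [Nat.cast_zero, zero_mul]
        positivity
      · rw [← hn s hs n, ← hn 1 one_pos j]
        apply hm
        · positivity
        · simpa using k1
    have c1 := mul_le_mul_of_nonneg_right k1 h1.le
    have c2 := mul_le_mul_of_nonneg_right k2.le h1.le
    rw [← abs_of_pos (show (0 : ℝ) < ((n + 1 : ℕ) : ℝ) by positivity), ← abs_mul,
      abs_le]
    constructor <;> nlinarith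
  by_contra hne
  have hpos : 0 < |g s - s * g 1| := abs_pos.2 (sub_ne_zero.2 hne)
  obtain ⟨n, hn'⟩ := exists_nat_gt (g 1 / |g s - s * g 1|)
  rw [div_lt_iff₀ hpos] at hn'
  have := bound n
  push_cast at this
  nlinarith

lemma fwd (hab : a < b) (hmap : ∀ p, IsLottery a b p → IsLottery a b (φ p))
    (hpos : PositiveLot a b φ) (hcoh : CoherentLot a b φ) (hw : WeaklyContinuousLot a b φ) :
    ∃ ψ : ℝ → ℝ, ContinuousOn ψ (Set.Icc a b) ∧
        (∀ x ∈ Set.Icc a b, 0 < ψ x) ∧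
        ∀ p, IsLottery a b p → ∀ x,
          φ p x = ψ x * p x / ∑ᶠ x', ψ x' * p x' := by
  have haI : a ∈ Set.Icc a b := ⟨le_rfl, hab.le⟩
  have hbI : b ∈ Set.Icc a b := ⟨hab.le, le_rfl⟩
  have cpos : ∀ x ∈ Set.Icc a b, ∀ y ∈ Set.Icc a b, x ≠ y → 0 < gg φ x y 1 :=
    fun x hx y hy h => gg_pos hmap hpos hx hy one_pos h
  have rat : ∀ p, IsLottery a b p → ∀ x y, x ≠ y → 0 < p x → 0 < p y →
      φ p x * p y = gg φ x y 1 * p x * φ p y := by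
    intro p hp x y hxy hx hy
    have h := ratio hmap hpos hcoh hp hxy hx hy
    have hxI := hp.2.2.1 x hx.ne'
    have hyI := hp.2.2.1 y hy.ne'
    rw [add_lin (g := gg φ x y) (fun s hs => gg_pos hmap hpos hxI hyI hs hxy)
      (fun s t hs ht => gg_add hab hmap hpos hcoh hw hxI hyI hs ht hxy) (by positivity)] at h
    rw [h]
    field_simp
  have cinv : ∀ x ∈ Set.Icc a b, ∀ y ∈ Set.Icc a b, x ≠ y → gg φ x y 1 * gg φ y x 1 = 1 := by
    intro x hx y hy hxy
    have hl := L2_lot hx hy one_pos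
    have hpx : L2 x y 1 x = 1 / 2 := by rw [L2_x one_pos hxy]; norm_num
    have hpy : L2 x y 1 y = 1 / 2 := by rw [L2_y hxy]; norm_num
    have r1 := rat _ hl x y hxy (by rw [hpx]; norm_num) (by rw [hpy]; norm_num)
    have r2 := rat _ hl y x hxy.symm (by rw [hpy]; norm_num) (by rw [hpx]; norm_num)
    have e := (gg_eq hmap hpos hx hy one_pos hxy).2.1
    rw [hpx, hpy] at r1 r2
    have : φ (L2 x y 1) x * (gg φ x y 1 * gg φ y x 1) = φ (L2 x y 1) x * 1 := by
      linear_combination (-2) * r1 - 2 * gg φ x y 1 * r2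
    exact mul_left_cancel₀ e.ne' this
  have ctri : ∀ x ∈ Set.Icc a b, ∀ y ∈ Set.Icc a b, ∀ z ∈ Set.Icc a b, x ≠ y → y ≠ z → x ≠ z →
      gg φ x z 1 = gg φ x y 1 * gg φ y z 1 := by
    intro x hx y hy z hz hxy hyz hxz
    have hl : IsLottery a b (T3 x y z 1 1 1) :=
      T3_lot hx hy hz zero_le_one zero_le_one zero_le_one (by norm_num)
    have p1 : T3 x y z 1 1 1 x = 1 / 3 := by simp [T3, hxy, hxz]; norm_num
    have p2 : T3 x y z 1 1 1 y = 1 / 3 := by simp [T3, hxy.symm, hyz]; norm_num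
    have p3 : T3 x y z 1 1 1 z = 1 / 3 := by simp [T3, hyz.symm, hxz.symm]; norm_num
    have q1 : 0 < T3 x y z 1 1 1 x := by rw [p1]; norm_num
    have q2 : 0 < T3 x y z 1 1 1 y := by rw [p2]; norm_num
    have q3 : 0 < T3 x y z 1 1 1 z := by rw [p3]; norm_num
    have r1 := rat _ hl x y hxy q1 q2
    have r2 := rat _ hl y z hyz q2 q3
    have r3 := rat _ hl x z hxz q1 q3
    have e := phi_pos hmap hpos hl q3
    rw [p1, p2] at r1
    rw [p2, p3] at r2
    rw [p1, p3] at r3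
    apply mul_right_cancel₀ e.ne'
    linear_combination (-3) * r3 + 3 * r1 + 3 * gg φ x y 1 * r2
  set ψ : ℝ → ℝ := fun x => if x = a then 1 else gg φ x a 1 with hψ
  have ψa : ψ a = 1 := by simp [hψ]
  have ψn : ∀ x, x ≠ a → ψ x = gg φ x a 1 := by
    intro x hx
    simp [hψ, hx]
  have ψpos : ∀ x ∈ Set.Icc a b, 0 < ψ x := by
    intro x hx
    by_cases h : x = a
    · rw [h, ψa]; exact one_pos
    · rw [ψn x h]; exact cpos x hx a haI h
  have ψc : ∀ x ∈ Set.Icc a b, ∀ y ∈ Set.Icc a b, x ≠ y → ψ x = gg φ x y 1 * ψ y := by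
    intro x hx y hy hxy
    by_cases h1 : x = a
    · subst h1
      rw [ψa, ψn y hxy.symm, cinv x hx y hy hxy]
    · by_cases h2 : y = a
      · subst h2
        rw [ψa, ψn x hxy, mul_one]
      · rw [ψn x h1, ψn y h2]
        exact ctri x hx y hy a haI hxy h2 h1
  refine ⟨ψ, ?_, ψpos, ?_⟩
  · rw [continuousOn_iff_continuous_domRestrict, continuous_iff_seqContinuous]
    intro u x hux
    have hlim : Tendsto (fun n => (u n : ℝ)) atTop (𝓝 (x : ℝ)) :=
      (continuous_subtype_val.tendsto x).comp hux
    obtain ⟨y, hy, hxy⟩ : ∃ y ∈ Set.Icc a b, (x : ℝ) ≠ y := by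
      by_cases h : (x : ℝ) = a
      · exact ⟨b, hbI, by rw [h]; exact hab.ne⟩
      · exact ⟨a, haI, h⟩
    have hg := (gg_tendsto hmap hpos hw x.2 hy one_pos hxy (fun n => (u n).2) hlim).mul_const (ψ y)
    rw [← ψc x x.2 y hy hxy] at hg
    refine hg.congr' ?_
    filter_upwards [hlim.eventually_ne hxy] with n hn
    exact (ψc _ (u n).2 y hy hn).symm
  · intro p hp x
    have hcross : ∀ y, φ p x * (ψ y * p y) = ψ x * p x * φ p y := by
      intro y
      by_cases hx0 : p x = 0
      · rw [(hpos p hp x).2 hx0, hx0]; ring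
      by_cases hy0 : p y = 0
      · rw [(hpos p hp y).2 hy0, hy0]; ring
      by_cases hxy : x = y
      · subst hxy; ring
      have hxI := hp.2.2.1 x hx0
      have hyI := hp.2.2.1 y hy0
      have r := rat p hp x y hxy (lt_of_le_of_ne (hp.1 x) (Ne.symm hx0))
        (lt_of_le_of_ne (hp.1 y) (Ne.symm hy0))
      rw [ψc x hxI y hyI hxy]
      linear_combination ψ y * r
    have hS : ∀ w, p w ≠ 0 → w ∈ hp.2.1.toFinset := by
      intro w hw
      simpa using hw
    have hsum : φ p x * ∑ᶠ y, ψ y * p y = ψ x * p x := by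
      rw [lot_sum hp ψ _ hS, Finset.mul_sum, Finset.sum_congr rfl (fun y _ => hcross y),
        ← Finset.mul_sum, lot_total (hmap p hp) _
          (fun w hw => hS w (fun h => hw ((hpos p hp w).2 h))), mul_one]
    have hne : ∑ᶠ y, ψ y * p y ≠ 0 := by
      rw [lot_sum hp ψ _ hS]
      apply ne_of_gt
      apply Finset.sum_pos
      · intro w hw
        have hw' : p w ≠ 0 := by simpa using hw
        exact mul_pos (ψpos w (hp.2.2.1 w hw')) (lt_of_le_of_ne (hp.1 w) (Ne.symm hw'))
      · by_contra hE
        rw [Finset.not_nonempty_iff_eq_empty] at hE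
        have := lot_total hp _ hS
        rw [hE] at this
        simp at this
    rw [eq_div_iff hne, hsum]

end fwd

lemma bwd {a b : ℝ} {φ : (ℝ → ℝ) → ℝ → ℝ} {ψ : ℝ → ℝ} (hc : ContinuousOn ψ (Set.Icc a b))
    (hψ : ∀ x ∈ Set.Icc a b, 0 < ψ x)
    (h : ∀ p, IsLottery a b p → ∀ x, φ p x = ψ x * p x / ∑ᶠ x', ψ x' * p x') :
    PositiveLot a b φ ∧ CoherentLot a b φ ∧ WeaklyContinuousLot a b φ := by
  have hS : ∀ p (hp : IsLottery a b p), ∀ w, p w ≠ 0 → w ∈ hp.2.1.toFinset := by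
    intro p hp w hw
    simpa using hw
  have hD : ∀ p, IsLottery a b p → 0 < ∑ᶠ x', ψ x' * p x' := by
    intro p hp
    rw [lot_sum hp ψ _ (hS p hp)]
    apply Finset.sum_pos
    · intro w hw
      have hw' : p w ≠ 0 := by simpa using hw
      exact mul_pos (hψ w (hp.2.2.1 w hw')) (lt_of_le_of_ne (hp.1 w) (Ne.symm hw'))
    · by_contra hE
      rw [Finset.not_nonempty_iff_eq_empty] at hE
      have := lot_total hp _ (hS p hp)
      rw [hE] at this
      simp at this
  refine ⟨?_, ?_, ?_⟩
  · intro p hp x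
    rw [h p hp x, div_eq_zero_iff, or_iff_left (hD p hp).ne']
    constructor
    · intro h0
      by_contra hx
      rcases mul_eq_zero.1 h0 with h1 | h1
      · exact (hψ x (hp.2.2.1 x hx)).ne' h1
      · exact hx h1
    · intro h0
      rw [h0, mul_zero]
  · intro p hp E hE hpE
    have hfin : ∀ f : ℝ → ℝ, (Function.support (fun w => f w * p w)).Finite := fun f =>
      hp.2.1.subset (fun w hw => right_ne_zero_of_mul hw)
    have hcl : IsLottery a b (condLot p E) := by
      refine ⟨?_, ?_, ?_, ?_⟩
      · intro x
        unfold condLot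
        split_ifs
        · exact div_nonneg (hp.1 x) hpE.le
        · exact le_rfl
      · refine hp.2.1.subset ?_
        intro x hx hx0
        apply hx
        simp [condLot, hx0]
      · intro x hx
        apply hp.2.2.1 x
        intro hx0
        apply hx
        simp [condLot, hx0]
      · have : ∀ x, condLot p E x = (∑ᶠ (_ : x ∈ E), p x) * (∑ᶠ x' ∈ E, p x')⁻¹ := by
          intro x
          by_cases hx : x ∈ E <;> simp [condLot, hx, div_eq_mul_inv]
        rw [finsum_congr this, ← finsum_mul, mul_inv_cancel₀ hpE.ne']
    have hfinE : ∀ f : ℝ → ℝ, (Function.support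
        (fun x => ∑ᶠ (_ : x ∈ E), f x * p x)).Finite := by
      intro f
      refine hp.2.1.subset ?_
      intro x hx hx0
      apply hx
      simp [hx0]
    have e1 : ∑ᶠ x', ψ x' * condLot p E x' =
        (∑ᶠ x' ∈ E, ψ x' * p x') * (∑ᶠ x' ∈ E, p x')⁻¹ := by
      rw [finsum_mul]
      apply finsum_congr
      intro x
      by_cases hx : x ∈ E <;> simp [condLot, hx, div_eq_mul_inv, mul_assoc]
    have e2 : ∑ᶠ x' ∈ E, φ p x' =
        (∑ᶠ x' ∈ E, ψ x' * p x') * (∑ᶠ x', ψ x' * p x')⁻¹ := by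
      rw [finsum_mul]
      apply finsum_congr
      intro x
      by_cases hx : x ∈ E <;> simp [h p hp x, hx, div_eq_mul_inv]
    funext x
    rw [h _ hcl x, e1]
    have hd := hD p hp
    have hc1 := hD _ hcl
    rw [e1] at hc1
    have hN : (∑ᶠ x' ∈ E, ψ x' * p x') ≠ 0 := left_ne_zero_of_mul hc1.ne'
    by_cases hx : x ∈ E
    · simp only [condLot, hx, if_true]
      rw [e2, h p hp x]
      field_simp
    · simp [condLot, hx]
  · intro pn q hpn hq hconv f hf hb
    have key : ∀ p, IsLottery a b p → ∑ᶠ x, f x * φ p x =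
        (∑ᶠ x, (f x * ψ x) * p x) / ∑ᶠ x, ψ x * p x := by
      intro p hp
      rw [div_eq_mul_inv, finsum_mul]
      apply finsum_congr
      intro x
      rw [h p hp x]
      ring
    have bdd : ∀ f : ℝ → ℝ, ContinuousOn f (Set.Icc a b) → ∃ M, ∀ x ∈ Set.Icc a b, |f x| ≤ M :=
      fun f hf => isCompact_Icc.exists_bound_of_continuousOn hf
    rw [key q hq]
    refine Tendsto.congr (fun n => (key (pn n) (hpn n)).symm) ?_
    exact (hconv _ (hf.mul hc) (bdd _ (hf.mul hc))).div (hconv _ hc (bdd _ hc)) (hD q hq).ne'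

/-- **Theorem**: a distorted belief `φ` on the simple lotteries on `X = [a,b]` is
positive, coherent and weakly continuous iff there is a continuous `ψ : X → ℝ₊₊` with
`φ(p)(x) = ψ(x)p(x) / Σ_{x'} ψ(x')p(x')`. -/
theorem stmt11 (a b : ℝ) (hab : a < b)
    (φ : (ℝ → ℝ) → ℝ → ℝ)
    (hmap : ∀ p, IsLottery a b p → IsLottery a b (φ p)) :
    (PositiveLot a b φ ∧ CoherentLot a b φ ∧ WeaklyContinuousLot a b φ) ↔
      ∃ ψ : ℝ → ℝ, ContinuousOn ψ (Set.Icc a b) ∧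
        (∀ x ∈ Set.Icc a b, 0 < ψ x) ∧
        ∀ p, IsLottery a b p → ∀ x,
          φ p x = ψ x * p x / ∑ᶠ x', ψ x' * p x' := by
  constructor
  · rintro ⟨h1, h2, h3⟩
    exact fwd hab hmap h1 h2 h3
  · rintro ⟨ψ, h1, h2, h3⟩
    exact bwd h1 h2 h3
end
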